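/- Let S be an S-tree. Then the vertex cover number of S equals |Core(S)|, and Core(S) is the unique minimum vertex cover of S; that is, every vertex cover of S of cardinality |Core(S)| equals Core(S). -/

import Mathlib

open scoped Classical

namespace NullDecomp

variable {V : Type*}

/-- The null space of the real adjacency matrix of a graph. -/
def nullSpace [Fintype V] (G : SimpleGraph V) : Set (V → ℝ) :=
  {x | Matrix.mulVec (G.adjMatrix ℝ) x = 0}

/-- The support of the null space: vertices with a nonzero entry in some null vector. -/
def supportSet [Fintype V] (G : SimpleGraph V) : Set V :=
  {v | ∃ x ∈ nullSpace G, x v ≠ 0}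

/-- The (open) neighborhood of a set of vertices. -/
def nbhdSet (G : SimpleGraph V) (A : Set V) : Set V :=
  {v | ∃ u ∈ A, G.Adj u v}

/-- The closed neighborhood of a set of vertices. -/
def closedNbhd (G : SimpleGraph V) (A : Set V) : Set V :=
  A ∪ nbhdSet G A

/-- The core of a graph: the neighborhood of the support of the null space. -/
def coreSet [Fintype V] (G : SimpleGraph V) : Set V :=
  nbhdSet G (supportSet G)

/-- A tree is an S-tree if the closed neighborhood of its support is everything. -/
def IsSTree [Fintype V] (G : SimpleGraph V) : Prop :=
  G.IsTree ∧ closedNbhd G (supportSet G) = Set.univ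

/-- A matching: a set of edges of `G`, pairwise disjoint. -/
def IsMatchingSet (G : SimpleGraph V) (M : Finset (Sym2 V)) : Prop :=
  (↑M : Set (Sym2 V)) ⊆ G.edgeSet ∧
    ∀ e ∈ M, ∀ f ∈ M, e ≠ f → ∀ v : V, v ∈ e → v ∉ f

/-- A maximum matching. -/
def IsMaxMatching [Fintype V] (G : SimpleGraph V) (M : Finset (Sym2 V)) : Prop :=
  IsMatchingSet G M ∧ ∀ M' : Finset (Sym2 V), IsMatchingSet G M' → M'.card ≤ M.card

/-- The matching number. -/
noncomputable def matchingNumber [Fintype V] (G : SimpleGraph V) : ℕ :=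
  sSup {n | ∃ M : Finset (Sym2 V), IsMatchingSet G M ∧ M.card = n}

/-- An independent set of vertices. -/
def IsIndep (G : SimpleGraph V) (A : Set V) : Prop :=
  ∀ u ∈ A, ∀ w ∈ A, ¬ G.Adj u w

/-- The independence number. -/
noncomputable def indepNumber [Fintype V] (G : SimpleGraph V) : ℕ :=
  sSup {n | ∃ A : Set V, IsIndep G A ∧ A.ncard = n}

/-- A vertex cover. -/
def IsVertexCover (G : SimpleGraph V) (Cs : Set V) : Prop :=
  ∀ e ∈ G.edgeSet, ∃ v ∈ Cs, v ∈ e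

/-- The vertex cover number. -/
noncomputable def coverNumber [Fintype V] (G : SimpleGraph V) : ℕ :=
  sInf {n | ∃ Cs : Set V, IsVertexCover G Cs ∧ Cs.ncard = n}

/-- The nullity of a graph: dimension of the kernel of its adjacency matrix. -/
noncomputable def nullity [Fintype V] (G : SimpleGraph V) : ℕ :=
  Module.finrank ℝ (LinearMap.ker (Matrix.mulVecLin (G.adjMatrix ℝ)))

/-- The number of maximum matchings of a graph. -/
noncomputable def numMaxMatchings [Fintype V] (G : SimpleGraph V) : ℕ :=
  Set.ncard {M : Finset (Sym2 V) | IsMaxMatching G M}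

/-- `C` is (the vertex set of) a connected component of the subgraph of `T`
induced by the closed neighborhood of the support of `T`. -/
def IsSComponent [Fintype V] (T : SimpleGraph V) (C : Set V) : Prop :=
  ∃ c : (T.induce (closedNbhd T (supportSet T))).ConnectedComponent,
    C = Subtype.val '' c.supp

/-- `C` is (the vertex set of) a connected component of the subgraph of `T`
induced by the complement of the closed neighborhood of the support of `T`. -/
def IsNComponent [Fintype V] (T : SimpleGraph V) (C : Set V) : Prop :=
  ∃ c : (T.induce ((closedNbhd T (supportSet T))ᶜ)).ConnectedComponent,
    C = Subtype.val '' c.supp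

/-- The zero-extension to `ℝ^V` of the null space of the subgraph of `T` induced by `C`:
vectors vanishing outside `C` whose restriction to `C` is a null vector of `T.induce C`. -/
noncomputable def extNull [Fintype V] (T : SimpleGraph V) (C : Set V) : Submodule ℝ (V → ℝ) :=
  LinearMap.ker ((Matrix.mulVecLin ((T.induce C).adjMatrix ℝ)).comp
      (LinearMap.funLeft ℝ ℝ (Subtype.val : ↥C → V))) ⊓
  LinearMap.ker (LinearMap.funLeft ℝ ℝ (Subtype.val : ↥(Cᶜ) → V))

theorem mem_nullSpace_iff [Fintype V] {G : SimpleGraph V} {x : V → ℝ} :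
    x ∈ nullSpace G ↔ ∀ v, ∑ u, (if G.Adj v u then x u else 0) = 0 := by
  simp [nullSpace, funext_iff, Matrix.mulVec, dotProduct, SimpleGraph.adjMatrix_apply]

/-- Two null vectors are proportional along an edge that is the only one leaving a set `D`. -/
theorem mul_eq_mul_of_unique_crossing_edge [Fintype V] {G : SimpleGraph V} {x y : V → ℝ}
    (hx : x ∈ nullSpace G) (hy : y ∈ nullSpace G) {D : Set V} {u v : V} (huv : G.Adj u v)
    (hu : u ∈ D) (hv : v ∉ D)
    (hD : ∀ i ∈ D, ∀ j ∉ D, G.Adj i j → i = u ∧ j = v) :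
    x u * y v = x v * y u := by
  rw [mem_nullSpace_iff] at hx hy
  have h1 : ∑ i, ∑ j, (if i ∈ D ∧ G.Adj i j then x i * y j else 0) = 0 := by
    refine Finset.sum_eq_zero fun i _ => ?_
    by_cases hi : i ∈ D
    · simpa [hi, Finset.mul_sum] using congrArg (x i * ·) (hy i)
    · simp [hi]
  have h2 : ∑ i, ∑ j, (if j ∈ D ∧ G.Adj i j then x i * y j else 0) = 0 := by
    rw [Finset.sum_comm]
    refine Finset.sum_eq_zero fun j _ => ?_
    by_cases hj : j ∈ D
    · simpa [hj, Finset.sum_mul, G.adj_comm j] using congrArg (· * y j) (hx j)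
    · simp [hj]
  have h3 : ∀ i j, (if i ∈ D ∧ G.Adj i j then x i * y j else 0) -
      (if j ∈ D ∧ G.Adj i j then x i * y j else 0) =
      (if i = u then if j = v then x u * y v else 0 else 0) -
      (if i = v then if j = u then x v * y u else 0 else 0) := by
    intro i j
    have hij := hD i
    have hji := hD j
    have hne := huv.ne
    have hvu := huv.symm
    have hs := G.adj_comm i j
    by_cases hi : i ∈ D <;> by_cases hj : j ∈ D <;> by_cases ha : G.Adj i j <;> grind
  have h4 : ∑ i, ∑ j, ((if i = u then if j = v then x u * y v else 0 else 0) -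
      (if i = v then if j = u then x v * y u else 0 else 0)) = (0 : ℝ) := by
    simp_rw [← h3, Finset.sum_sub_distrib]
    rw [h1, h2, sub_zero]
  simp_rw [Finset.sum_sub_distrib] at h4
  rw [Finset.sum_eq_single u (by simp_all) (by simp),
    Finset.sum_eq_single v (by simp_all) (by simp)] at h4
  simpa [sub_eq_zero] using h4

/-- Flipping the sign of a null vector on one colour class gives a null vector. -/
theorem sign_mul_mem_nullSpace [Fintype V] {G : SimpleGraph V} {σ x : V → ℝ}
    (hσ : ∀ i j, G.Adj i j → σ j = -σ i) (hx : x ∈ nullSpace G) :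
    (fun v => σ v * x v) ∈ nullSpace G := by
  rw [mem_nullSpace_iff] at hx ⊢
  intro v
  trans -σ v * ∑ u, (if G.Adj v u then x u else 0)
  swap
  · rw [hx v, mul_zero]
  rw [Finset.mul_sum]
  refine Finset.sum_congr rfl fun u _ => ?_
  split_ifs with h
  · rw [hσ v u h]
  · rw [mul_zero]

/-- The support of an acyclic graph is independent. -/
theorem isIndep_supportSet [Fintype V] {G : SimpleGraph V} (hG : G.IsAcyclic) :
    IsIndep G (supportSet G) := by
  rintro u ⟨x, hx, hxu⟩ v ⟨y, hy, hyv⟩ huv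
  obtain ⟨c⟩ := hG.isBipartite
  set σ : V → ℝ := fun w => if c w = 0 then 1 else -1 with hσ_def
  have hσ : ∀ i j, G.Adj i j → σ j = -σ i := by
    intro i j hij
    have key : ∀ p q : Fin 2, p ≠ q → (q = 0 ↔ ¬ p = 0) := by decide
    have hc := key _ _ (c.valid hij)
    by_cases hi : c i = 0 <;> simp [hσ_def, hc, hi]
  have hσu : σ u ≠ 0 := by
    simp only [hσ_def]; split_ifs <;> norm_num
  set D : Set V := {w | (G.deleteEdges {s(u, v)}).Reachable u w} with hD_def
  have hbr : v ∉ D := SimpleGraph.isBridge_iff.1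
    (SimpleGraph.isAcyclic_iff_forall_adj_isBridge.1 hG huv)
  have huD : u ∈ D := SimpleGraph.Reachable.refl u
  have hD : ∀ i ∈ D, ∀ j ∉ D, G.Adj i j → i = u ∧ j = v := by
    intro i hi j hj hij
    by_contra hne
    by_cases he : s(i, j) = s(u, v)
    · rcases Sym2.eq_iff.1 he with h | ⟨rfl, rfl⟩
      · exact hne h
      · exact hbr hi
    · refine hj (SimpleGraph.Reachable.trans hi (SimpleGraph.Adj.reachable ?_))
      rw [SimpleGraph.deleteEdges_adj]
      exact ⟨hij, he⟩
  have e1 := mul_eq_mul_of_unique_crossing_edge hx hy huv huD hbr hD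
  have e2 := mul_eq_mul_of_unique_crossing_edge (sign_mul_mem_nullSpace hσ hx) hy huv huD hbr hD
  simp only [hσ u v huv] at e2
  have e3 : σ u * (x u * y v) = 0 := by linear_combination (e2 + σ u * e1) / 2
  exact mul_ne_zero hσu (mul_ne_zero hxu hyv) e3

/-- A vertex of the core has at least two neighbors in the support. -/
theorem exists_two_adj_supportSet [Fintype V] {G : SimpleGraph V} {a : V} (ha : a ∈ coreSet G) :
    ∃ b ∈ supportSet G, ∃ c ∈ supportSet G, b ≠ c ∧ G.Adj a b ∧ G.Adj a c := by
  obtain ⟨b, ⟨x, hx, hxb⟩, hab⟩ := ha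
  by_contra! h
  have hsum := mem_nullSpace_iff.1 hx a
  rw [Finset.sum_eq_single b, if_pos hab.symm] at hsum
  · exact hxb hsum
  · intro c _ hcb
    split_ifs with hac
    · by_contra hxc
      exact h b ⟨x, hx, hxb⟩ c ⟨x, hx, hxc⟩ hcb.symm hab.symm hac
    · rfl
  · simp

theorem card_edgeFinset_lt_of_isAcyclic {W : Type*} [Fintype W] [Nonempty W] {H : SimpleGraph W}
    (hH : H.IsAcyclic) : H.edgeFinset.card < Fintype.card W := by
  obtain ⟨T, hle, -, hT⟩ :=
    SimpleGraph.connected_top.exists_isTree_le_of_le_of_isAcyclic le_top hH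
  have h1 := hT.card_edgeFinset
  have h2 := Finset.card_le_card (SimpleGraph.edgeFinset_mono hle)
  omega

/-- In an acyclic graph whose vertices are split into `s` and its complement, if every vertex of `s`
has two neighbors outside `s`, then `s` is smaller than its complement. -/
theorem card_lt_card_compl_of_isAcyclic {W : Type*} [Fintype W] [Nonempty W] {H : SimpleGraph W}
    (hH : H.IsAcyclic) (s : Finset W)
    (h : ∀ a ∈ s, ∃ b ∉ s, ∃ c ∉ s, b ≠ c ∧ H.Adj a b ∧ H.Adj a c) :
    s.card < sᶜ.card := by
  obtain ⟨B, hB⟩ : ∃ B, B = H.between (s : Set W) ((sᶜ : Finset W) : Set W) := ⟨_, rfl⟩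
  have hbip : B.IsBipartiteWith (s : Set W) ((sᶜ : Finset W) : Set W) :=
    hB ▸ SimpleGraph.between_isBipartiteWith (Finset.disjoint_coe.2 disjoint_compl_right)
  have hsum := SimpleGraph.isBipartiteWith_sum_degrees_eq_card_edges hbip
  have hlt : B.edgeFinset.card < _ :=
    card_edgeFinset_lt_of_isAcyclic (hH.anti (hB ▸ SimpleGraph.between_le : B ≤ H))
  have hdeg : ∀ a ∈ s, 2 ≤ B.degree a := by
    intro a ha
    obtain ⟨b, hb, c, hc, hbc, hab, hac⟩ := h a ha
    rw [← Finset.card_pair hbc, ← SimpleGraph.card_neighborFinset_eq_degree]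
    refine Finset.card_le_card ?_
    simp [Finset.insert_subset_iff, hB, SimpleGraph.between_adj, ha, hb, hc, hab, hac]
  have hge := Finset.card_nsmul_le_sum s _ 2 hdeg
  have hcard := Finset.card_add_card_compl s
  have hlt' : s.card * 2 < Fintype.card W := by
    rw [smul_eq_mul, hsum] at hge
    refine hge.trans_lt (lt_of_eq_of_lt ?_ hlt)
    congr!
  omega

/-- In an acyclic graph, if every vertex of a nonempty set `A` has two neighbors in a disjoint
set `B`, then `A` is smaller than `B`. -/
theorem ncard_lt_ncard_of_isAcyclic [Finite V] {G : SimpleGraph V} (hG : G.IsAcyclic) {A B : Set V}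
    (hAB : Disjoint A B) (hA : A.Nonempty)
    (h : ∀ a ∈ A, ∃ b ∈ B, ∃ c ∈ B, b ≠ c ∧ G.Adj a b ∧ G.Adj a c) :
    A.ncard < B.ncard := by
  have := Fintype.ofFinite V
  obtain ⟨a₀, ha₀⟩ := hA
  have : Nonempty ↥(A ∪ B) := ⟨⟨a₀, Or.inl ha₀⟩⟩
  let s : Finset ↥(A ∪ B) := Finset.univ.filter fun w => w.1 ∈ A
  have hnot : ∀ b ∈ B, b ∉ A := fun b hb ha => Set.disjoint_left.1 hAB ha hb
  have hlt := card_lt_card_compl_of_isAcyclic (hG.induce (A ∪ B)) s (by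
    rintro ⟨a, haW⟩ haS
    obtain ⟨b, hb, c, hc, hbc, hab, hac⟩ := h a (by simpa [s] using haS)
    exact ⟨⟨b, Or.inr hb⟩, by simpa [s] using hnot b hb, ⟨c, Or.inr hc⟩,
      by simpa [s] using hnot c hc, fun e => hbc (congrArg Subtype.val e), hab, hac⟩)
  have hs : Subtype.val '' (s : Set ↥(A ∪ B)) = A := by
    ext v
    simp +contextual [s]
  have hsc : Subtype.val '' ((sᶜ : Finset ↥(A ∪ B)) : Set ↥(A ∪ B)) = B := by
    ext v
    have := hnot v
    simp [s]
    tauto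
  have hsA := Set.ncard_image_of_injective (s : Set ↥(A ∪ B)) Subtype.val_injective
  have hsB := Set.ncard_image_of_injective ((sᶜ : Finset ↥(A ∪ B)) : Set ↥(A ∪ B))
    Subtype.val_injective
  rw [hs, Set.ncard_coe_finset] at hsA
  rw [hsc, Set.ncard_coe_finset] at hsB
  rw [hsA, hsB]
  convert hlt

theorem IsVertexCover.mem_or_mem {G : SimpleGraph V} {C : Set V} (hC : IsVertexCover G C) {u v : V}
    (huv : G.Adj u v) : u ∈ C ∨ v ∈ C := by
  obtain ⟨w, hw, hmem⟩ := hC s(u, v) huv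
  rcases Sym2.mem_iff.1 hmem with rfl | rfl
  · exact Or.inl hw
  · exact Or.inr hw

theorem isVertexCover_coreSet [Fintype V] {S : SimpleGraph V} (hS : IsSTree S) :
    IsVertexCover S (coreSet S) := by
  intro e
  induction e using Sym2.ind with
  | _ u v =>
    intro (huv : S.Adj u v)
    rcases (hS.2.symm ▸ Set.mem_univ u : u ∈ closedNbhd S (supportSet S)) with hu | hu
    · exact ⟨v, ⟨u, hu, huv⟩, Sym2.mem_mk_right u v⟩
    · exact ⟨u, hu, Sym2.mem_mk_left u v⟩

/-- A vertex cover of an acyclic graph missing a vertex of the core is larger than the core. -/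
theorem ncard_coreSet_lt [Fintype V] {G : SimpleGraph V} (hG : G.IsAcyclic) {C : Set V}
    (hC : IsVertexCover G C) (hsub : ¬ coreSet G ⊆ C) : (coreSet G).ncard < C.ncard := by
  have hdisj : Disjoint (coreSet G) (supportSet G) := by
    rw [Set.disjoint_left]
    rintro a ⟨b, hb, hba⟩ ha
    exact isIndep_supportSet hG b hb a ha hba
  have hlt : (coreSet G \ C).ncard < (C ∩ supportSet G).ncard := by
    refine ncard_lt_ncard_of_isAcyclic hG ?_ (Set.sdiff_nonempty.2 hsub) ?_
    · exact hdisj.mono Set.sdiff_subset Set.inter_subset_right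
    · rintro a ⟨haK, haC⟩
      obtain ⟨b, hb, c, hc, hbc, hab, hac⟩ := exists_two_adj_supportSet haK
      exact ⟨b, ⟨(hC.mem_or_mem hab).resolve_left haC, hb⟩, c,
        ⟨(hC.mem_or_mem hac).resolve_left haC, hc⟩, hbc, hab, hac⟩
  calc (coreSet G).ncard = (coreSet G ∩ C).ncard + (coreSet G \ C).ncard :=
        (Set.ncard_inter_add_ncard_sdiff_eq_ncard _ _).symm
    _ < (coreSet G ∩ C).ncard + (C ∩ supportSet G).ncard := by omega
    _ = ((coreSet G ∩ C) ∪ (C ∩ supportSet G)).ncard :=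
        (Set.ncard_union_eq (hdisj.mono Set.inter_subset_left Set.inter_subset_right)).symm
    _ ≤ C.ncard := Set.ncard_le_ncard (Set.union_subset Set.inter_subset_right Set.inter_subset_left)

/-- For an S-tree, the vertex cover number equals `|Core(S)|`, and the core
is the unique minimum vertex cover. -/
theorem stmt9 [Fintype V] (S : SimpleGraph V) (hS : IsSTree S) :
    coverNumber S = (coreSet S).ncard ∧
      ∀ Cs : Set V, IsVertexCover S Cs → Cs.ncard = (coreSet S).ncard → Cs = coreSet S := by
  refine ⟨le_antisymm (Nat.sInf_le ⟨_, isVertexCover_coreSet hS, rfl⟩) ?_, ?_⟩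
  · refine le_csInf ⟨_, _, isVertexCover_coreSet hS, rfl⟩ ?_
    rintro _ ⟨C, hC, rfl⟩
    by_cases hsub : coreSet S ⊆ C
    · exact Set.ncard_le_ncard hsub
    · exact (ncard_coreSet_lt hS.1.isAcyclic hC hsub).le
  · intro C hC hcard
    by_cases hsub : coreSet S ⊆ C
    · exact (Set.eq_of_subset_of_ncard_le hsub hcard.le).symm
    · exact absurd hcard (ncard_coreSet_lt hS.1.isAcyclic hC hsub).ne'

end NullDecomp
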